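/- γ_MB(P_3 □ P_4) = 5 and γ_MB'(P_3 □ P_4) = 6 for the Maker-Breaker domination game on the 3×4 grid graph. -/

import Mathlib

open SimpleGraph

namespace MBD

variable {V : Type*}

/-- Dominator's claimed set `D` is a dominating set of `G`. -/
def Dominates (G : SimpleGraph V) (D : Finset V) : Prop :=
  ∀ v : V, ∃ d ∈ D, d = v ∨ G.Adj d v

/-- Staller's claimed set `S` contains the whole closed neighborhood of some vertex. -/
def StallerWinSet (G : SimpleGraph V) (S : Finset V) : Prop :=
  ∃ v : V, ∀ u : V, (u = v ∨ G.Adj u v) → u ∈ S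

variable [DecidableEq V]

mutual
  /-- `DomD G k D S`: with Dominator having claimed `D`, Staller `S`, and Dominator to
  move, Dominator has a strategy winning the Maker-Breaker domination game on `G`
  using at most `k` further moves of his own. -/
  inductive DomD (G : SimpleGraph V) : ℕ → Finset V → Finset V → Prop
    | win {k : ℕ} {D S : Finset V} : Dominates G D → DomD G k D S
    | move {k : ℕ} {D S : Finset V} (v : V) : v ∉ D → v ∉ S →
        DomS G k (insert v D) S → DomD G (k + 1) D S
  /-- Like `DomD`, but it is Staller's turn to move. -/
  inductive DomS (G : SimpleGraph V) : ℕ → Finset V → Finset V → Prop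
    | win {k : ℕ} {D S : Finset V} : Dominates G D → DomS G k D S
    | move {k : ℕ} {D S : Finset V} : (∃ v : V, v ∉ D ∧ v ∉ S) →
        (∀ v : V, v ∉ D → v ∉ S → DomD G k D (insert v S)) → DomS G k D S
end

mutual
  /-- `StallD G k D S`: with Dominator having claimed `D`, Staller `S`, and Dominator to
  move, Staller has a strategy winning (claiming a whole closed neighborhood) within at
  most `k` further moves of her own. -/
  inductive StallD (G : SimpleGraph V) : ℕ → Finset V → Finset V → Prop
    | win {k : ℕ} {D S : Finset V} : StallerWinSet G S → StallD G k D S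
    | move {k : ℕ} {D S : Finset V} : (∃ v : V, v ∉ D ∧ v ∉ S) →
        (∀ v : V, v ∉ D → v ∉ S → StallS G k (insert v D) S) → StallD G k D S
  /-- Like `StallD`, but it is Staller's turn to move. -/
  inductive StallS (G : SimpleGraph V) : ℕ → Finset V → Finset V → Prop
    | win {k : ℕ} {D S : Finset V} : StallerWinSet G S → StallS G k D S
    | move {k : ℕ} {D S : Finset V} (v : V) : v ∉ D → v ∉ S →
        StallD G k D (insert v S) → StallS G (k + 1) D S
end

/-- Dominator has a winning strategy in the D-game (Dominator starts). -/
def DominatorWinsD (G : SimpleGraph V) : Prop := ∃ k, DomD G k ∅ ∅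

/-- Dominator has a winning strategy in the S-game (Staller starts). -/
def DominatorWinsS (G : SimpleGraph V) : Prop := ∃ k, DomS G k ∅ ∅

/-- Staller has a winning strategy in the D-game (Dominator starts). -/
def StallerWinsD (G : SimpleGraph V) : Prop := ∃ k, StallD G k ∅ ∅

/-- Staller has a winning strategy in the S-game (Staller starts). -/
def StallerWinsS (G : SimpleGraph V) : Prop := ∃ k, StallS G k ∅ ∅

/-- Outcome `𝒟`: Dominator wins both the D-game and the S-game. -/
def outcomeD (G : SimpleGraph V) : Prop := DominatorWinsD G ∧ DominatorWinsS G

/-- Outcome `𝒮`: Staller wins both the D-game and the S-game. -/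
def outcomeS (G : SimpleGraph V) : Prop := StallerWinsD G ∧ StallerWinsS G

/-- Outcome `𝒩`: the first player wins in both games. -/
def outcomeN (G : SimpleGraph V) : Prop := DominatorWinsD G ∧ StallerWinsS G

/-- `γ_MB(G)`: the minimum number of Dominator's moves needed to win the D-game,
`∞` if he has no winning strategy. -/
noncomputable def gMB (G : SimpleGraph V) : ℕ∞ :=
  sInf ((fun k : ℕ => (k : ℕ∞)) '' {k | DomD G k ∅ ∅})

/-- `γ_MB'(G)`: the minimum number of Dominator's moves needed to win the S-game. -/
noncomputable def gMB' (G : SimpleGraph V) : ℕ∞ :=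
  sInf ((fun k : ℕ => (k : ℕ∞)) '' {k | DomS G k ∅ ∅})

/-- `γ_SMB(G)`: the minimum number of Staller's moves needed to win the D-game. -/
noncomputable def gSMB (G : SimpleGraph V) : ℕ∞ :=
  sInf ((fun k : ℕ => (k : ℕ∞)) '' {k | StallD G k ∅ ∅})

/-- `γ_SMB'(G)`: the minimum number of Staller's moves needed to win the S-game. -/
noncomputable def gSMB' (G : SimpleGraph V) : ℕ∞ :=
  sInf ((fun k : ℕ => (k : ℕ∞)) '' {k | StallS G k ∅ ∅})

end MBD

namespace MBD

section Game

variable {V : Type*} {G : SimpleGraph V} {k : ℕ} {D S : Finset V}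

theorem not_dominates_of_closedNeighborhood {v : V}
    (hv : ∀ u, u = v ∨ G.Adj u v → u ∉ D) : ¬ Dominates G D := fun h =>
  let ⟨d, hd, hdv⟩ := h v
  hv d hdv hd

variable [DecidableEq V]

theorem domD_zero_iff : DomD G 0 D S ↔ Dominates G D :=
  ⟨fun h => by cases h; assumption, .win⟩

theorem domD_succ_iff :
    DomD G (k + 1) D S ↔ Dominates G D ∨ ∃ v, v ∉ D ∧ v ∉ S ∧ DomS G k (insert v D) S := by
  constructor
  · rintro (h | ⟨v, hD, hS, h⟩)
    exacts [.inl h, .inr ⟨v, hD, hS, h⟩]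
  · rintro (h | ⟨v, hD, hS, h⟩)
    exacts [.win h, .move v hD hS h]

theorem domS_iff :
    DomS G k D S ↔ Dominates G D ∨ (∃ v, v ∉ D ∧ v ∉ S) ∧
      ∀ v, v ∉ D → v ∉ S → DomD G k D (insert v S) := by
  constructor
  · rintro (h | ⟨h₁, h₂⟩)
    exacts [.inl h, .inr ⟨h₁, h₂⟩]
  · rintro (h | ⟨h₁, h₂⟩)
    exacts [.win h, .move h₁ h₂]

theorem domD_and_domS_succ (k : ℕ) :
    (∀ D S, DomD G k D S → DomD G (k + 1) D S) ∧
      ∀ D S, DomS G k D S → DomS G (k + 1) D S := by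
  have key (k : ℕ) (h : ∀ D S, DomD G k D S → DomD G (k + 1) D S) (D S : Finset V)
      (hS : DomS G k D S) : DomS G (k + 1) D S := by
    rw [domS_iff] at hS ⊢
    exact hS.imp_right fun hm => ⟨hm.1, fun v hv hv' => h _ _ (hm.2 v hv hv')⟩
  induction k with
  | zero =>
    have h (D S : Finset V) (hD : DomD G 0 D S) : DomD G 1 D S := .win (domD_zero_iff.1 hD)
    exact ⟨h, key 0 h⟩
  | succ k ih =>
    have h (D S : Finset V) (hD : DomD G (k + 1) D S) : DomD G (k + 2) D S := by
      rw [domD_succ_iff] at hD ⊢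
      exact hD.imp_right fun ⟨v, hv, hv', hm⟩ => ⟨v, hv, hv', ih.2 _ _ hm⟩
    exact ⟨h, key _ h⟩

theorem DomD.mono {l : ℕ} (hkl : k ≤ l) (h : DomD G k D S) : DomD G l D S := by
  induction hkl with
  | refl => exact h
  | step _ ih => exact (domD_and_domS_succ _).1 _ _ ih

theorem DomS.mono {l : ℕ} (hkl : k ≤ l) (h : DomS G k D S) : DomS G l D S := by
  induction hkl with
  | refl => exact h
  | step _ ih => exact (domD_and_domS_succ _).2 _ _ ih

/-- Dominator cannot win once Staller owns a closed neighborhood. -/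
theorem not_domD_of_closedNeighborhood {v : V} (k : ℕ) (hD : ∀ u, u = v ∨ G.Adj u v → u ∉ D)
    (hS : ∀ u, u = v ∨ G.Adj u v → u ∈ S) : ¬ DomD G k D S := by
  induction k generalizing D S with
  | zero => exact fun h => not_dominates_of_closedNeighborhood hD (domD_zero_iff.1 h)
  | succ k ih =>
    intro h
    obtain h | ⟨x, -, hxS, h⟩ := domD_succ_iff.1 h
    · exact not_dominates_of_closedNeighborhood hD h
    have hD' : ∀ u, u = v ∨ G.Adj u v → u ∉ insert x D := by
      intro u hu hmem
      obtain rfl | hmem := Finset.mem_insert.1 hmem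
      exacts [hxS (hS _ hu), hD u hu hmem]
    obtain h | ⟨⟨y, hyD, hyS⟩, h⟩ := domS_iff.1 h
    · exact not_dominates_of_closedNeighborhood hD' h
    · exact ih hD' (fun u hu => Finset.mem_insert_of_mem (hS u hu)) (h y hyD hyS)

/-- Staller to move wins if a closed neighborhood is hers up to one free vertex. -/
theorem not_domS_of_threat {v x : V} (hD : ∀ u, u = v ∨ G.Adj u v → u ∉ D)
    (hx : x = v ∨ G.Adj x v) (hxS : x ∉ S)
    (hS : ∀ u, u = v ∨ G.Adj u v → u ≠ x → u ∈ S) : ¬ DomS G k D S := by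
  intro h
  obtain h | ⟨-, h⟩ := domS_iff.1 h
  · exact not_dominates_of_closedNeighborhood hD h
  · refine not_domD_of_closedNeighborhood k hD (fun u hu => ?_) (h x (hD x hx) hxS)
    by_cases hux : u = x
    · simp [hux]
    · exact Finset.mem_insert_of_mem (hS u hu hux)

/-- Dominator to move has to answer a threat. -/
theorem domD_succ_iff_of_threat {v x : V} (hD : ∀ u, u = v ∨ G.Adj u v → u ∉ D)
    (hx : x = v ∨ G.Adj x v) (hxS : x ∉ S)
    (hS : ∀ u, u = v ∨ G.Adj u v → u ≠ x → u ∈ S) :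
    DomD G (k + 1) D S ↔ DomS G k (insert x D) S := by
  refine ⟨fun h => ?_, .move x (hD x hx) hxS⟩
  obtain h | ⟨y, hyD, hyS, h⟩ := domD_succ_iff.1 h
  · exact absurd h (not_dominates_of_closedNeighborhood hD)
  by_cases hyx : y = x
  · rwa [← hyx]
  refine absurd h (not_domS_of_threat (fun u hu hmem => ?_) hx hxS hS)
  obtain rfl | hmem := Finset.mem_insert.1 hmem
  exacts [hyS (hS _ hu hyx), hD u hu hmem]

/-- A perfect matching gives Dominator a pairing strategy as second player. -/
theorem domS_of_pairing [Fintype V] {f : V → V} (hf : Function.Involutive f)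
    (hadj : ∀ v, G.Adj (f v) v) (hDS : ∀ v, v ∈ D ↔ f v ∈ S)
    (hk : (Finset.univ \ (D ∪ S)).card ≤ 2 * k) : DomS G k D S := by
  induction k generalizing D S with
  | zero =>
    refine .win fun v => ?_
    have hv : v ∈ D ∪ S := by
      have : Finset.univ \ (D ∪ S) = ∅ := Finset.card_eq_zero.1 (by omega)
      simpa using Finset.sdiff_eq_empty_iff_subset.1 this (Finset.mem_univ v)
    obtain hv | hv := Finset.mem_union.1 hv
    · exact ⟨v, hv, .inl rfl⟩
    · exact ⟨f v, (hDS _).2 (by rwa [hf v]), .inr (hadj v)⟩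
  | succ k ih =>
    by_cases hfree : ∃ v, v ∉ D ∧ v ∉ S
    · refine .move hfree fun v hD hS => ?_
      have hfD : f v ∉ D := by rwa [hDS, hf v]
      have hfS : f v ∉ S := by rwa [← hDS]
      refine .move (f v) hfD (by simp [(hadj v).ne, hfS]) (ih (fun u => ?_) ?_)
      · rw [Finset.mem_insert, Finset.mem_insert, ← hDS, hf.eq_iff]
      · have heq : Finset.univ \ (insert (f v) D ∪ insert v S) =
            ((Finset.univ \ (D ∪ S)).erase v).erase (f v) := by
          ext u; simp; tauto
        rw [heq, Finset.card_erase_of_mem (by simp [(hadj v).ne, hfD, hfS]),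
          Finset.card_erase_of_mem (by simp [hD, hS])]
        omega
    · push Not at hfree
      refine .win fun v => ?_
      by_cases hv : v ∈ D
      · exact ⟨v, hv, .inl rfl⟩
      · exact ⟨f v, (hDS _).2 (by rw [hf v]; exact hfree v hv), .inr (hadj v)⟩

theorem sInf_image_natCast_eq {P : ℕ → Prop} {n : ℕ} (hmono : ∀ k l, k ≤ l → P k → P l)
    (hn : P (n + 1)) (hn' : ¬ P n) :
    sInf ((fun k : ℕ => (k : ℕ∞)) '' {k | P k}) = (n + 1 : ℕ) := by
  refine IsLeast.csInf_eq ⟨⟨_, hn, rfl⟩, ?_⟩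
  rintro _ ⟨k, hk, rfl⟩
  by_contra! h
  exact hn' (hmono k n (by simpa [Nat.lt_succ_iff] using (Nat.cast_lt.1 h)) hk)

theorem gMB_eq (h : DomD G (k + 1) ∅ ∅) (h' : ¬ DomD G k ∅ ∅) : gMB G = (k + 1 : ℕ) :=
  sInf_image_natCast_eq (P := fun k => DomD G k ∅ ∅) (fun _ _ hkl => DomD.mono hkl) h h'

theorem gMB'_eq (h : DomS G (k + 1) ∅ ∅) (h' : ¬ DomS G k ∅ ∅) : gMB' G = (k + 1 : ℕ) :=
  sInf_image_natCast_eq (P := fun k => DomS G k ∅ ∅) (fun _ _ hkl => DomS.mono hkl) h h'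

end Game

namespace Grid

/-- The `3 × 4` grid graph. -/
abbrev grid : SimpleGraph (Fin 3 × Fin 4) := SimpleGraph.boxProd (pathGraph 3) (pathGraph 4)

/-- The bit of a vertex when sets of vertices are encoded as bit masks. -/
def code (v : Fin 3 × Fin 4) : ℕ := 4 * v.1 + v.2

/-- The masks of the closed neighborhoods. -/
def nbhds : List ℕ := [19, 39, 78, 140, 305, 626, 1252, 2248, 784, 1824, 3648, 3200]

/-- The mask of the closed neighborhood of a vertex. -/
def mask (v : Fin 3 × Fin 4) : ℕ := nbhds.getD (code v) 0

/-- Does `d` meet all masks in the list? -/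
def meetsAll (d : ℕ) (l : List ℕ) : Bool :=
  List.rec true (fun n _ r => bif Nat.beq (Nat.land n d) 0 then false else r) l

/-- The index of a bit completing `s` to contain a mask of the list that avoids `d`. -/
def threat (d s : ℕ) (l : List ℕ) : Option ℕ :=
  List.rec none (fun n _ r =>
    bif Nat.beq (Nat.land n d) 0 then
      bif Nat.beq (Nat.xor n (Nat.land n s)) (Nat.pow 2 (Nat.log2 (Nat.xor n (Nat.land n s)))) then
        some (Nat.log2 (Nat.xor n (Nat.land n s)))
      else r
    else r) l

/-- Some bit of the list outside `o` satisfies `f`. -/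
def anyFree (o : ℕ) (f : ℕ → Bool) (l : List ℕ) : Bool :=
  List.rec false (fun i _ r =>
    bif Nat.beq (Nat.land o (Nat.pow 2 i)) 0 then bif f i then true else r else r) l

/-- Solve the position with Staller to move, where `f` solves the positions after her move
and `ms` lists the bits in the order in which they are tried. -/
def solveS (ms : List ℕ) (f : ℕ → ℕ → Bool) (d s : ℕ) : Bool :=
  bif meetsAll d nbhds then true
  else match threat d s nbhds with
    | some _ => false
    | none =>
      bif anyFree (Nat.lor d s) (fun _ => true) ms then
        !anyFree (Nat.lor d s) (fun i => !f d (Nat.lor s (Nat.pow 2 i))) ms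
      else false

/-- Solve the position with Dominator to move and `k` moves left for him. -/
def solveD (md ms : List ℕ) : ℕ → ℕ → ℕ → Bool
  | 0, d, _ => meetsAll d nbhds
  | k + 1, d, s =>
    bif meetsAll d nbhds then true
    else match threat d s nbhds with
      | some i => solveS ms (solveD md ms k) (Nat.lor d (Nat.pow 2 i)) s
      | none =>
        anyFree (Nat.lor d s) (fun i => solveS ms (solveD md ms k) (Nat.lor d (Nat.pow 2 i)) s) md

theorem code_lt (v : Fin 3 × Fin 4) : code v < 12 := by
  unfold code; omega

theorem code_injective : Function.Injective code := by
  rintro ⟨a, b⟩ ⟨c, d⟩ h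
  simp only [code] at h
  ext <;> simp <;> omega

theorem exists_code_eq {i : ℕ} (hi : i < 12) : ∃ v, code v = i :=
  ⟨(⟨i / 4, by omega⟩, ⟨i % 4, by omega⟩), by simp only [code]; omega⟩

theorem testBit_mask (v u : Fin 3 × Fin 4) :
    (mask v).testBit (code u) = true ↔ u = v ∨ grid.Adj u v := by
  simp only [boxProd_adj, pathGraph_adj]
  revert v u
  decide

theorem mask_lt (v : Fin 3 × Fin 4) : mask v < 2 ^ 12 := by
  revert v; decide

theorem mem_nbhds {n : ℕ} : n ∈ nbhds ↔ ∃ v, mask v = n := by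
  constructor
  · have : ∀ n ∈ nbhds, ∃ v, mask v = n := by decide
    exact this n
  · rintro ⟨v, rfl⟩
    revert v; decide

theorem exists_code_eq_of_testBit_mask {v : Fin 3 × Fin 4} {i : ℕ}
    (h : (mask v).testBit i = true) : ∃ u, code u = i := by
  refine exists_code_eq ?_
  by_contra! hi
  rw [Nat.testBit_lt_two_pow ((mask_lt v).trans_le (Nat.pow_le_pow_right two_pos hi))] at h
  simp at h

/-- The mask `m` represents the set `A`. -/
def Represents (m : ℕ) (A : Finset (Fin 3 × Fin 4)) : Prop :=
  ∀ v, m.testBit (code v) = true ↔ v ∈ A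

theorem represents_empty : Represents 0 ∅ := fun v => by simp

theorem Represents.insert {m : ℕ} {A : Finset (Fin 3 × Fin 4)} (h : Represents m A)
    (v : Fin 3 × Fin 4) : Represents (Nat.lor m (Nat.pow 2 (code v))) (insert v A) := by
  intro u
  change (m ||| 2 ^ code v).testBit (code u) = true ↔ _
  rw [Nat.testBit_or, Nat.testBit_two_pow, Finset.mem_insert, Bool.or_eq_true, h u,
    decide_eq_true_iff, code_injective.eq_iff, or_comm, eq_comm]

variable {d s : ℕ} {D S : Finset (Fin 3 × Fin 4)}

theorem mask_land_eq_zero_iff (hd : Represents d D) (v : Fin 3 × Fin 4) :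
    Nat.land (mask v) d = 0 ↔ ∀ u, u = v ∨ grid.Adj u v → u ∉ D := by
  change mask v &&& d = 0 ↔ _
  constructor
  · intro h u hu hD
    have := congrArg (Nat.testBit · (code u)) h
    simp [(testBit_mask v u).2 hu, (hd u).2 hD] at this
  · intro h
    refine Nat.eq_of_testBit_eq fun i => ?_
    rw [Nat.testBit_and, Nat.zero_testBit, Bool.and_eq_false_imp]
    intro hi
    obtain ⟨u, rfl⟩ := exists_code_eq_of_testBit_mask hi
    rw [← Bool.not_eq_true, hd u]
    exact h u ((testBit_mask v u).1 hi)

theorem meetsAll_cons (d n : ℕ) (l : List ℕ) :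
    meetsAll d (n :: l) = bif Nat.beq (Nat.land n d) 0 then false else meetsAll d l := rfl

theorem meetsAll_iff {l : List ℕ} : meetsAll d l = true ↔ ∀ n ∈ l, Nat.land n d ≠ 0 := by
  induction l with
  | nil => simp [meetsAll]
  | cons n l ih =>
    rw [List.forall_mem_cons, ← ih, meetsAll_cons]
    cases h : Nat.beq (Nat.land n d) 0
    · simpa using fun _ => Nat.ne_of_beq_eq_false h
    · simpa using fun h' => absurd (Nat.eq_of_beq_eq_true h) h'

theorem meetsAll_nbhds_iff (hd : Represents d D) :
    meetsAll d nbhds = true ↔ Dominates grid D := by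
  rw [meetsAll_iff]
  constructor
  · intro h v
    have := h _ (mem_nbhds.2 ⟨v, rfl⟩)
    rw [Ne, mask_land_eq_zero_iff hd] at this
    push Not at this
    obtain ⟨u, hu, hD⟩ := this
    exact ⟨u, hD, hu⟩
  · intro h n hn hz
    obtain ⟨v, rfl⟩ := mem_nbhds.1 hn
    exact not_dominates_of_closedNeighborhood ((mask_land_eq_zero_iff hd v).1 hz) h

theorem threat_cons (d s n : ℕ) (l : List ℕ) :
    threat d s (n :: l) =
      bif Nat.beq (Nat.land n d) 0 then
        bif Nat.beq (Nat.xor n (Nat.land n s))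
            (Nat.pow 2 (Nat.log2 (Nat.xor n (Nat.land n s)))) then
          some (Nat.log2 (Nat.xor n (Nat.land n s)))
        else threat d s l
      else threat d s l := rfl

theorem exists_of_threat_eq_some {l : List ℕ} {i : ℕ} (h : threat d s l = some i) :
    ∃ n ∈ l, Nat.land n d = 0 ∧ n ^^^ (n &&& s) = 2 ^ i := by
  induction l with
  | nil => simp [threat] at h
  | cons n l ih =>
    have ih' (h : threat d s l = some i) :
        ∃ m ∈ n :: l, Nat.land m d = 0 ∧ m ^^^ (m &&& s) = 2 ^ i :=
      let ⟨m, hm, hm'⟩ := ih h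
      ⟨m, List.mem_cons_of_mem _ hm, hm'⟩
    rw [threat_cons] at h
    cases h₁ : Nat.beq (Nat.land n d) 0 <;> rw [h₁] at h
    · exact ih' h
    cases h₂ : Nat.beq (Nat.xor n (Nat.land n s))
      (Nat.pow 2 (Nat.log2 (Nat.xor n (Nat.land n s)))) <;> rw [h₂] at h
    · exact ih' h
    obtain rfl := Option.some.inj h
    exact ⟨n, List.mem_cons_self, Nat.eq_of_beq_eq_true h₁, Nat.eq_of_beq_eq_true h₂⟩

theorem exists_of_threat_nbhds (hd : Represents d D) (hs : Represents s S) {i : ℕ}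
    (h : threat d s nbhds = some i) :
    ∃ v x, code x = i ∧ (∀ u, u = v ∨ grid.Adj u v → u ∉ D) ∧ (x = v ∨ grid.Adj x v) ∧ x ∉ S ∧
      ∀ u, u = v ∨ grid.Adj u v → u ≠ x → u ∈ S := by
  obtain ⟨n, hn, hnd, hns⟩ := exists_of_threat_eq_some h
  obtain ⟨v, rfl⟩ := mem_nbhds.1 hn
  have bits (j : ℕ) : ((mask v).testBit j = true ∧ s.testBit j = false) ↔ i = j := by
    have := congrArg (Nat.testBit · j) hns
    simp only [Nat.testBit_xor, Nat.testBit_and, Nat.testBit_two_pow] at this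
    rw [← decide_eq_true_iff (p := i = j), ← this]
    cases (mask v).testBit j <;> cases s.testBit j <;> simp
  obtain ⟨hi, his⟩ := (bits i).2 rfl
  obtain ⟨x, rfl⟩ := exists_code_eq_of_testBit_mask hi
  refine ⟨v, x, rfl, (mask_land_eq_zero_iff hd v).1 hnd, (testBit_mask v x).1 hi, ?_, ?_⟩
  · rw [← hs x, his]; simp
  · intro u hu hux
    by_contra huS
    rw [← hs u, Bool.not_eq_true] at huS
    exact hux (code_injective ((bits _).1 ⟨(testBit_mask v u).2 hu, huS⟩)).symm

theorem anyFree_cons (o : ℕ) (f : ℕ → Bool) (i : ℕ) (l : List ℕ) :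
    anyFree o f (i :: l) =
      bif Nat.beq (Nat.land o (Nat.pow 2 i)) 0 then bif f i then true else anyFree o f l
      else anyFree o f l := rfl

theorem anyFree_iff {o : ℕ} {f : ℕ → Bool} {l : List ℕ} :
    anyFree o f l = true ↔ ∃ i ∈ l, o.testBit i = false ∧ f i = true := by
  induction l with
  | nil => simp [anyFree]
  | cons i l ih =>
    have hi : Nat.beq (Nat.land o (Nat.pow 2 i)) 0 = !o.testBit i := by
      change Nat.beq (o &&& 2 ^ i) 0 = _
      rw [Nat.and_two_pow]
      cases o.testBit i
      · simp
      · rw [Bool.toNat_true, one_mul]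
        exact Bool.eq_false_iff.2 fun h => (Nat.two_pow_pos i).ne' (Nat.eq_of_beq_eq_true h)
    rw [anyFree_cons, hi]
    cases h : o.testBit i <;> cases h' : f i <;> simp_all

theorem anyFree_lor_iff (hd : Represents d D) (hs : Represents s S) {f : ℕ → Bool} {l : List ℕ}
    (hl : ∀ i, i ∈ l ↔ i < 12) :
    anyFree (Nat.lor d s) f l = true ↔ ∃ v, v ∉ D ∧ v ∉ S ∧ f (code v) = true := by
  have free (v : Fin 3 × Fin 4) : (Nat.lor d s).testBit (code v) = false ↔ v ∉ D ∧ v ∉ S := by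
    change (d ||| s).testBit (code v) = false ↔ _
    rw [← hd v, ← hs v, Nat.testBit_or]
    simp
  rw [anyFree_iff]
  constructor
  · rintro ⟨i, hi, ho, hf⟩
    obtain ⟨v, rfl⟩ := exists_code_eq ((hl i).1 hi)
    exact ⟨v, ((free v).1 ho).1, ((free v).1 ho).2, hf⟩
  · rintro ⟨v, hD, hS, hf⟩
    exact ⟨code v, (hl _).2 (code_lt v), (free v).2 ⟨hD, hS⟩, hf⟩

theorem solveS_iff {ms : List ℕ} (hms : ∀ i, i ∈ ms ↔ i < 12) {k : ℕ} {f : ℕ → ℕ → Bool}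
    (hf : ∀ {d s D S}, Represents d D → Represents s S → (f d s = true ↔ DomD grid k D S))
    (hd : Represents d D) (hs : Represents s S) :
    solveS ms f d s = true ↔ DomS grid k D S := by
  unfold solveS
  cases h₁ : meetsAll d nbhds with
  | true => simpa using DomS.win ((meetsAll_nbhds_iff hd).1 h₁)
  | false =>
    rw [← Bool.not_eq_true, meetsAll_nbhds_iff hd] at h₁
    cases h₂ : threat d s nbhds with
    | some i =>
      obtain ⟨v, x, -, hvD, hxv, hxS, hvS⟩ := exists_of_threat_nbhds hd hs h₂
      simpa using not_domS_of_threat hvD hxv hxS hvS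
    | none =>
      rw [domS_iff, or_iff_right h₁]
      simp only [cond_false, Bool.cond_false_right, Bool.and_eq_true, Bool.not_eq_true',
        ← Bool.not_eq_true, anyFree_lor_iff hd hs hms, and_true]
      refine and_congr_right fun _ => ?_
      push Not
      refine forall_congr' fun v => forall_congr' fun _ => forall_congr' fun _ => ?_
      rw [← hf hd (hs.insert v)]

theorem solveD_iff {md ms : List ℕ} (hmd : ∀ i, i ∈ md ↔ i < 12) (hms : ∀ i, i ∈ ms ↔ i < 12)
    {k : ℕ} (hd : Represents d D) (hs : Represents s S) :
    solveD md ms k d s = true ↔ DomD grid k D S := by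
  induction k generalizing d s D S with
  | zero => rw [domD_zero_iff, ← meetsAll_nbhds_iff hd, solveD]
  | succ k ih =>
    unfold solveD
    cases h₁ : meetsAll d nbhds with
    | true => simpa using DomD.win ((meetsAll_nbhds_iff hd).1 h₁)
    | false =>
      rw [← Bool.not_eq_true, meetsAll_nbhds_iff hd] at h₁
      cases h₂ : threat d s nbhds with
      | some i =>
        obtain ⟨v, x, rfl, hvD, hxv, hxS, hvS⟩ := exists_of_threat_nbhds hd hs h₂
        rw [domD_succ_iff_of_threat hvD hxv hxS hvS]
        exact solveS_iff hms ih (hd.insert x) hs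
      | none =>
        rw [domD_succ_iff, or_iff_right h₁]
        simp only [cond_false, anyFree_lor_iff hd hs hmd]
        refine exists_congr fun v => and_congr_right fun _ => and_congr_right fun _ => ?_
        exact solveS_iff hms ih (hd.insert v) hs

theorem mem_iff_of_perm {l : List ℕ} (h : l.Perm (List.range 12)) (i : ℕ) : i ∈ l ↔ i < 12 := by
  rw [h.mem_iff, List.mem_range]

theorem domD_five : DomD grid 5 ∅ ∅ :=
  (solveD_iff (md := [1, 10, 8, 7, 3, 4, 11, 2, 5, 9, 0, 6])
    (ms := [3, 5, 7, 4, 10, 1, 11, 8, 9, 2, 0, 6]) (mem_iff_of_perm (by decide))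
    (mem_iff_of_perm (by decide)) represents_empty represents_empty).1 (by decide +kernel)

theorem not_domD_four : ¬ DomD grid 4 ∅ ∅ := by
  rw [← solveD_iff (md := [9, 0, 1, 4, 10, 6, 7, 3, 11, 8, 5, 2])
    (ms := [4, 7, 2, 1, 9, 3, 10, 8, 11, 5, 0, 6]) (mem_iff_of_perm (by decide))
    (mem_iff_of_perm (by decide)) represents_empty represents_empty]
  decide +kernel

theorem not_domS_five : ¬ DomS grid 5 ∅ ∅ := by
  have hd := mem_iff_of_perm (l := [4, 10, 1, 5, 7, 8, 3, 11, 0, 9, 6, 2]) (by decide)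
  have hs := mem_iff_of_perm (l := [7, 11, 2, 3, 10, 5, 8, 6, 0, 4, 9, 1]) (by decide)
  rw [← solveS_iff hs (solveD_iff hd hs) represents_empty represents_empty]
  decide +kernel

/-- Exchanges the first two columns and the last two columns. -/
def partner (v : Fin 3 × Fin 4) : Fin 3 × Fin 4 := (v.1, ![1, 0, 3, 2] v.2)

theorem domS_six : DomS grid 6 ∅ ∅ := by
  refine domS_of_pairing (f := partner) (by unfold Function.Involutive; decide) (fun v => ?_)
    (by simp) (by simp)
  simp only [boxProd_adj, pathGraph_adj]
  revert v
  decide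

end Grid

end MBD

/-- `γ_MB(P_3 □ P_4) = 5` and `γ_MB'(P_3 □ P_4) = 6`. -/
theorem stmt_15 :
    MBD.gMB (SimpleGraph.pathGraph 3 □ SimpleGraph.pathGraph 4) = 5 ∧
    MBD.gMB' (SimpleGraph.pathGraph 3 □ SimpleGraph.pathGraph 4) = 6 :=
  ⟨MBD.gMB_eq MBD.Grid.domD_five MBD.Grid.not_domD_four,
    MBD.gMB'_eq MBD.Grid.domS_six MBD.Grid.not_domS_five⟩
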